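/- Let n ≥ 1, ε ∈ {−1, 1}, and let ρ = ∑_{k=1}^n a_k e_k ∈ ℤⁿ with a_k ∈ {0, ε} for all k and ρ ≠ 0. Then |R(ρ)| ≥ n, and |R(ρ)| = n if and only if |supp(ρ)| = 1 or |supp(ρ)| = n, equivalently if and only if ρ = ±eᵢ for some i ∈ {0, 1, …, n} (where e₀ := −(e₁ + ⋯ + eₙ)). -/

import Mathlib

open Pointwise

section Lattice

/-- The standard dot product on `ℤⁿ`. -/
def dotZ {n : ℕ} (x y : Fin n → ℤ) : ℤ := ∑ i, x i * y i

/-- The set of Demazure roots of a set `S ⊆ ℤⁿ`. -/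
def demRoots {n : ℕ} (S : Set (Fin n → ℤ)) : Set (Fin n → ℤ) :=
  {α | ∃ ρ ∈ S, dotZ ρ α = -1 ∧ ∀ ρ' ∈ S, ρ' ≠ ρ → 0 ≤ dotZ ρ' α}

/-- The standard basis vector `eᵢ` of `ℤⁿ`. -/
def eZ (n : ℕ) (i : Fin n) : Fin n → ℤ := Pi.single i 1

/-- `e₀ := −(e₁ + ⋯ + eₙ)`, i.e. the all-(−1) vector. -/
def e0Z (n : ℕ) : Fin n → ℤ := fun _ => -1

/-- `Sₙ := {e₀, e₁, …, eₙ}`, the 1-skeleton (ray generators) of `ℙⁿ`. -/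
def SnZ (n : ℕ) : Set (Fin n → ℤ) := insert (e0Z n) (Set.range (eZ n))

/-- `Rₙ := {eᵢ} ∪ {−eᵢ} ∪ {eᵢ − eⱼ : i ≠ j}`, the root system of `PGL_{n+1}`. -/
def RnZ (n : ℕ) : Set (Fin n → ℤ) :=
  Set.range (eZ n) ∪ Set.range (fun i => -eZ n i) ∪
    {α | ∃ i j : Fin n, i ≠ j ∧ α = eZ n i - eZ n j}

end Lattice

/-- `R(ρ) := {α ∈ Rₙ : ⟨ρ, α⟩ = −1}`. -/
def RofRho (n : ℕ) (ρ : Fin n → ℤ) : Set (Fin n → ℤ) :=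
  {α | α ∈ RnZ n ∧ dotZ ρ α = -1}

/-- `supp(ρ)`: the set of indices of nonzero coordinates of `ρ`. -/
def suppZ (n : ℕ) (ρ : Fin n → ℤ) : Set (Fin n) := {k | ρ k ≠ 0}

theorem dotZ_eZ {n : ℕ} (ρ : Fin n → ℤ) (i : Fin n) : dotZ ρ (eZ n i) = ρ i := by
  simp [dotZ, eZ, Pi.single_apply]

theorem dotZ_sub {n : ℕ} (ρ x y : Fin n → ℤ) : dotZ ρ (x - y) = dotZ ρ x - dotZ ρ y := by
  simp [dotZ, mul_sub, Finset.sum_sub_distrib]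

theorem dotZ_neg {n : ℕ} (ρ x : Fin n → ℤ) : dotZ ρ (-x) = -dotZ ρ x := by
  simp [dotZ]

/-- The basis vectors of `ℤⁿ` together with the zero vector, indexed by `Option (Fin n)`. -/
def eZOption (n : ℕ) (x : Option (Fin n)) : Fin n → ℤ := x.elim 0 (eZ n)

theorem eZOption_apply {n : ℕ} (x : Option (Fin n)) (k : Fin n) :
    eZOption n x k = if x = some k then 1 else 0 := by
  cases x <;> simp [eZOption, eZ, Pi.single_apply, eq_comm]

theorem eZOption_sub_eZ_injOn {n : ℕ} (ε : ℤ) (hε : ε ≠ 0) (S : Finset (Fin n)) :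
    Set.InjOn (fun p : Option (Fin n) × Fin n => ε • (eZOption n p.1 - eZ n p.2))
      (Finset.insertNone Sᶜ ×ˢ S : Finset (Option (Fin n) × Fin n)) := by
  rintro ⟨x, j⟩ hx ⟨y, l⟩ hy h
  simp only [Finset.coe_product, Set.mem_prod, Finset.mem_coe, Finset.mem_insertNone,
    Finset.mem_compl] at hx hy
  have h' : ∀ k, eZOption n x k - eZ n j k = eZOption n y k - eZ n l k :=
    congrFun (smul_right_injective _ hε h)
  simp only [eZOption_apply, eZ, Pi.single_apply] at h'
  have hxj : x ≠ some j := fun e => hx.1 j (by simp [e]) hx.2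
  obtain rfl : j = l := by
    by_contra hne
    have := h' j
    split_ifs at this <;> simp_all
  have hxy : ∀ k, x = some k ↔ y = some k := fun k => by
    have := h' k
    split_ifs at this <;> simp_all
  exact Prod.ext (Option.ext hxy) rfl

theorem RofRho_eq_image {n : ℕ} {ε : ℤ} (hε : ε = -1 ∨ ε = 1) (ρ : Fin n → ℤ)
    (hρ : ∀ k, ρ k = 0 ∨ ρ k = ε) (S : Finset (Fin n)) (hS : ∀ k, k ∈ S ↔ ρ k ≠ 0) :
    RofRho n ρ = (fun p : Option (Fin n) × Fin n => ε • (eZOption n p.1 - eZ n p.2)) ''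
      (Finset.insertNone Sᶜ ×ˢ S : Finset (Option (Fin n) × Fin n)) := by
  have hval : ∀ k, k ∈ S → ρ k = ε := fun k hk => (hρ k).resolve_left ((hS k).1 hk)
  have hzero : ∀ k, k ∉ S → ρ k = 0 := fun k hk => by simpa [hS] using hk
  ext α
  simp only [RofRho, RnZ, Set.mem_ofPred_eq, Set.mem_union, Set.mem_range, Set.mem_image,
    Prod.exists, Finset.coe_product, Set.mem_prod, Finset.mem_coe, Finset.mem_insertNone,
    Finset.mem_compl]
  constructor
  · rintro ⟨(⟨i, rfl⟩ | ⟨i, rfl⟩) | ⟨i, j, hij, rfl⟩, h⟩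
    · rw [dotZ_eZ] at h
      have hi : i ∈ S := (hS i).2 (by omega)
      obtain rfl : ε = -1 := by rw [← hval i hi, h]
      exact ⟨none, i, ⟨by simp, hi⟩, by simp [eZOption]⟩
    · rw [dotZ_neg, dotZ_eZ] at h
      have hi : i ∈ S := (hS i).2 (by omega)
      obtain rfl : ε = 1 := by rw [← hval i hi]; omega
      exact ⟨none, i, ⟨by simp, hi⟩, by simp [eZOption]⟩
    · rw [dotZ_sub, dotZ_eZ, dotZ_eZ] at h
      have h1 := hρ i
      have h2 := hρ j
      rcases hε with rfl | rfl
      · exact ⟨some j, i, ⟨by rintro _ ⟨⟩; rw [hS]; omega, (hS i).2 (by omega)⟩,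
          by simp [eZOption]⟩
      · exact ⟨some i, j, ⟨by rintro _ ⟨⟩; rw [hS]; omega, (hS j).2 (by omega)⟩,
          by simp [eZOption]⟩
  · rintro ⟨x, j, ⟨hx, hj⟩, rfl⟩
    have hρj := hval j hj
    cases x with
    | none =>
      rcases hε with rfl | rfl
      · exact ⟨.inl (.inl ⟨j, by simp [eZOption]⟩), by simp [eZOption, dotZ_eZ, hρj]⟩
      · exact ⟨.inl (.inr ⟨j, by simp [eZOption]⟩), by simp [eZOption, dotZ_neg, dotZ_eZ, hρj]⟩
    | some i =>
      have hi : i ∉ S := hx i rfl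
      have hij : i ≠ j := fun e => hi (e ▸ hj)
      have hρi := hzero i hi
      rcases hε with rfl | rfl
      · exact ⟨.inr ⟨j, i, hij.symm, by simp [eZOption]⟩,
          by simp [eZOption, dotZ_sub, dotZ_eZ, hρj, hρi]⟩
      · exact ⟨.inr ⟨i, j, hij, by simp [eZOption]⟩,
          by simp [eZOption, dotZ_sub, dotZ_eZ, hρj, hρi]⟩

theorem ncard_RofRho {n : ℕ} {ε : ℤ} (hε : ε = -1 ∨ ε = 1) (ρ : Fin n → ℤ)
    (hρ : ∀ k, ρ k = 0 ∨ ρ k = ε) :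
    (RofRho n ρ).ncard = (n - (suppZ n ρ).ncard + 1) * (suppZ n ρ).ncard := by
  obtain ⟨S, hS⟩ : ∃ S : Finset (Fin n), (S : Set (Fin n)) = suppZ n ρ :=
    ⟨_, (Set.toFinite (suppZ n ρ)).coe_toFinset⟩
  rw [RofRho_eq_image hε ρ hρ S (fun k => by rw [← Finset.mem_coe, hS]; rfl),
    Set.InjOn.ncard_image (eZOption_sub_eZ_injOn _ (by omega) S), ← hS, Set.ncard_coe_finset,
    Set.ncard_coe_finset, Finset.card_product, Finset.card_insertNone, Finset.card_compl,
    Fintype.card_fin]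

theorem ncard_suppZ_eq_one_iff {n : ℕ} {ε : ℤ} (hε : ε = -1 ∨ ε = 1) (ρ : Fin n → ℤ)
    (hρ : ∀ k, ρ k = 0 ∨ ρ k = ε) :
    (suppZ n ρ).ncard = 1 ↔ ∃ i : Fin n, ρ = eZ n i ∨ ρ = -eZ n i := by
  rw [Set.ncard_eq_one]
  refine exists_congr fun i => ⟨fun h => ?_, ?_⟩
  · have hk : ∀ k, ρ k ≠ 0 ↔ k = i := fun k => Set.ext_iff.1 h k
    have key : ∀ k, ρ k = ε * eZ n i k := fun k => by
      by_cases hki : k = i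
      · simpa [eZ, hki] using (hρ i).resolve_left ((hk i).2 rfl)
      · simpa [eZ, hki] using mt (hk k).1 hki
    rcases hε with rfl | rfl
    · exact .inr (funext fun k => by simp [key])
    · exact .inl (funext fun k => by simp [key])
  · rintro (rfl | rfl) <;> ext k <;> simp [suppZ, eZ, Pi.single_apply]

theorem ncard_suppZ_eq_iff {n : ℕ} {ε : ℤ} (hε : ε = -1 ∨ ε = 1) (ρ : Fin n → ℤ)
    (hρ : ∀ k, ρ k = 0 ∨ ρ k = ε) :
    (suppZ n ρ).ncard = n ↔ ρ = e0Z n ∨ ρ = -e0Z n := by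
  constructor
  · intro h
    have huniv : suppZ n ρ = Set.univ :=
      Set.eq_of_subset_of_ncard_le (Set.subset_univ _) (by simp [h])
    have key : ∀ k, ρ k = ε := fun k =>
      (hρ k).resolve_left (huniv ▸ Set.mem_univ k : k ∈ suppZ n ρ)
    rcases hε with rfl | rfl
    · exact .inl (funext fun k => by simp [key, e0Z])
    · exact .inr (funext fun k => by simp [key, e0Z])
  · rintro (rfl | rfl) <;> simp [suppZ, e0Z]

/-- `|R(ρ)| ≥ n`, with equality iff `|supp(ρ)| ∈ {1, n}`, equivalently iff
`ρ = ±eᵢ` for some `i ∈ {0, 1, …, n}`. -/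
theorem RofRho_card_ge (n : ℕ) (hn : 1 ≤ n) (ε : ℤ) (hε : ε = -1 ∨ ε = 1)
    (ρ : Fin n → ℤ) (hρ : ∀ k, ρ k = 0 ∨ ρ k = ε) (hρ0 : ρ ≠ 0) :
    n ≤ (RofRho n ρ).ncard ∧
    ((RofRho n ρ).ncard = n ↔ (suppZ n ρ).ncard = 1 ∨ (suppZ n ρ).ncard = n) ∧
    ((RofRho n ρ).ncard = n ↔
      (∃ i : Fin n, ρ = eZ n i ∨ ρ = -eZ n i) ∨ ρ = e0Z n ∨ ρ = -e0Z n) := by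
  rw [← ncard_suppZ_eq_one_iff hε ρ hρ, ← ncard_suppZ_eq_iff hε ρ hρ, and_self_iff,
    ncard_RofRho hε ρ hρ]
  have hpos : 1 ≤ (suppZ n ρ).ncard :=
    (Set.ncard_pos (Set.toFinite _)).2 (Function.ne_iff.1 hρ0)
  have hle : (suppZ n ρ).ncard ≤ n := by
    simpa using Set.ncard_le_card (suppZ n ρ)
  generalize (suppZ n ρ).ncard = s at hpos hle
  obtain ⟨a, rfl⟩ := Nat.exists_eq_add_of_le' hpos
  obtain ⟨b, rfl⟩ := Nat.exists_eq_add_of_le hle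
  have hcard : (a + 1 + b - (a + 1) + 1) * (a + 1) = a + 1 + b + a * b := by
    rw [Nat.add_sub_cancel_left]; ring
  rw [hcard]
  refine ⟨by omega, ?_⟩
  rw [Nat.add_eq_left, Nat.mul_eq_zero]
  omega
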